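/- arXiv:1101.6036 — 6 statements merged into one kernel-verified Lean document; each statement's English description precedes it below -/
import Mathlib

section
/- Let M be a Hausdorff topological space, f : M → M a homeomorphism, and N ⊆ M a nonempty compact set with f(N) ⊆ interior(N). Then A := ⋂_{k≥0} f^{k}(N) is a nonempty compact set contained in interior(N), and moreover A = ⋂_{k≥0} f^{k}(interior N). -/
/-- If `M` is Hausdorff, `f : M → M` a homeomorphism and `N` a nonempty compact trapping
region (`f(N) ⊆ interior N`), then the attractor `A = ⋂ k, f^[k] '' N` is nonempty, compact,
contained in `interior N`, and equals `⋂ k, f^[k] '' interior N`. -/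
theorem attractor_nonempty_compact {M : Type*} [TopologicalSpace M] [T2Space M]
    (f : M ≃ₜ M) (N : Set M) (hne : N.Nonempty) (hcpt : IsCompact N)
    (hN : ⇑f '' N ⊆ interior N) :
    (⋂ k : ℕ, (⇑f)^[k] '' N).Nonempty ∧
      IsCompact (⋂ k : ℕ, (⇑f)^[k] '' N) ∧
      (⋂ k : ℕ, (⇑f)^[k] '' N) ⊆ interior N ∧
      (⋂ k : ℕ, (⇑f)^[k] '' N) = ⋂ k : ℕ, (⇑f)^[k] '' interior N := by
  have hsucc (k : ℕ) : (⇑f)^[k + 1] '' N ⊆ (⇑f)^[k] '' interior N := by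
    rw [Function.iterate_succ, Set.image_comp]
    exact Set.image_mono hN
  have hanti (k : ℕ) : (⇑f)^[k + 1] '' N ⊆ (⇑f)^[k] '' N :=
    (hsucc k).trans (Set.image_mono interior_subset)
  have hcompact (k : ℕ) : IsCompact ((⇑f)^[k] '' N) := hcpt.image (f.continuous.iterate k)
  have hle (k : ℕ) : (⋂ k : ℕ, (⇑f)^[k] '' N) ⊆ (⇑f)^[k] '' interior N :=
    (Set.iInter_subset _ (k + 1)).trans (hsucc k)
  refine ⟨?_, ?_, ?_, ?_⟩
  · exact IsCompact.nonempty_iInter_of_sequence_nonempty_isCompact_isClosed _ hanti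
      (fun k => hne.image _) (hcompact 0) fun k => (hcompact k).isClosed
  · exact (hcompact 0).of_isClosed_subset (isClosed_iInter fun k => (hcompact k).isClosed)
      (Set.iInter_subset _ 0)
  · simpa using hle 0
  · exact (Set.subset_iInter hle).antisymm
      (Set.iInter_mono fun k => Set.image_mono interior_subset)
end

section
/- Let M be a topological space, f : M → M a homeomorphism, and B₁, B₂ ⊆ M disjoint nonempty sets with f(B₁) ⊆ interior(B₁) and f(B₂) ⊆ interior(B₂). Then the basin ⋃_{k≥0} f^{-k}(interior(B₁ ∪ B₂)) of the trapping region B₁ ∪ B₂ is disconnected (not preconnected): it is the union of two disjoint nonempty open sets, namely the basins of B₁ and of B₂. -/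
/-- The union of the images of `s` under the iterates of `f⁻¹` is the set of points some iterate of
which lies in `s`. -/
theorem Homeomorph.mem_iUnion_iterate_symm_image {M : Type*} [TopologicalSpace M] (f : M ≃ₜ M)
    (s : Set M) (x : M) : x ∈ ⋃ k : ℕ, (⇑f.symm)^[k] '' s ↔ ∃ k : ℕ, (⇑f)^[k] x ∈ s := by
  have h (k : ℕ) : (⇑f.symm)^[k] '' s = (⇑f)^[k] ⁻¹' s :=
    congrFun (Set.image_eq_preimage_of_inverse
      (Function.LeftInverse.iterate f.apply_symm_apply k)
      (Function.LeftInverse.iterate f.symm_apply_apply k)) s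
  simp [h]

/-- Orbits never leave the interior of a trapping region. -/
theorem iterate_mem_interior_of_le {M : Type*} [TopologicalSpace M] {f : M → M} {N : Set M}
    (hN : f '' N ⊆ interior N) {x : M} {j k : ℕ} (hjk : j ≤ k) (hx : f^[j] x ∈ interior N) :
    f^[k] x ∈ interior N := by
  induction k, hjk using Nat.le_induction with
  | base => exact hx
  | succ k _ ih =>
    rw [Function.iterate_succ_apply']
    exact hN (Set.mem_image_of_mem f (interior_subset ih))

/-- If `B₁`, `B₂` are disjoint nonempty trapping regions for a homeomorphism `f`, then the
basin `⋃ k, f⁻¹^[k] '' interior (B₁ ∪ B₂)` of the trapping region `B₁ ∪ B₂` is disconnected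
(not preconnected). -/
theorem basin_of_union_not_preconnected {M : Type*} [TopologicalSpace M] (f : M ≃ₜ M)
    (B₁ B₂ : Set M) (hdisj : Disjoint B₁ B₂) (hne₁ : B₁.Nonempty) (hne₂ : B₂.Nonempty)
    (h₁ : ⇑f '' B₁ ⊆ interior B₁) (h₂ : ⇑f '' B₂ ⊆ interior B₂) :
    ¬ IsPreconnected (⋃ k : ℕ, (⇑f.symm)^[k] '' interior (B₁ ∪ B₂)) := by
  have hopen (N : Set M) : IsOpen (⋃ k : ℕ, (⇑f)^[k] ⁻¹' interior N) :=
    isOpen_iUnion fun k ↦ isOpen_interior.preimage (f.continuous.iterate k)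
  have hmeets (N : Set M) (hN : N.Nonempty) (hf : ⇑f '' N ⊆ interior N) (hsub : N ⊆ B₁ ∪ B₂) :
      ((⋃ k : ℕ, (⇑f.symm)^[k] '' interior (B₁ ∪ B₂)) ∩
        ⋃ k : ℕ, (⇑f)^[k] ⁻¹' interior N).Nonempty := by
    obtain ⟨x, hx⟩ := hN
    have hfx : f x ∈ interior N := hf (Set.mem_image_of_mem f hx)
    exact ⟨x, (f.mem_iUnion_iterate_symm_image _ x).2 ⟨1, interior_mono hsub hfx⟩,
      Set.mem_iUnion.2 ⟨1, hfx⟩⟩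
  intro hpre
  obtain ⟨x, -, hx₁, hx₂⟩ := hpre _ _ (hopen B₁) (hopen B₂)
    (by
      intro x hx
      obtain ⟨k, hk⟩ := (f.mem_iUnion_iterate_symm_image _ x).1 hx
      refine (interior_subset hk).imp (fun h ↦ ?_) (fun h ↦ ?_) <;>
        refine Set.mem_iUnion.2 ⟨k + 1, ?_⟩ <;>
        rw [Set.mem_preimage, Function.iterate_succ_apply']
      · exact h₁ (Set.mem_image_of_mem f h)
      · exact h₂ (Set.mem_image_of_mem f h))
    (hmeets B₁ hne₁ h₁ Set.subset_union_left) (hmeets B₂ hne₂ h₂ Set.subset_union_right)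
  obtain ⟨j, hj⟩ := Set.mem_iUnion.1 hx₁
  obtain ⟨k, hk⟩ := Set.mem_iUnion.1 hx₂
  exact Set.disjoint_left.1 hdisj
    (interior_subset (iterate_mem_interior_of_le h₁ (le_max_left j k) hj))
    (interior_subset (iterate_mem_interior_of_le h₂ (le_max_right j k) hk))
end

section
/- Let M be a topological space, f : M → M a bijection with set of periodic points Ω, and φ : M → ℝ a continuous Lyapunov function for f. Let c ∈ ℝ be such that φ(p) ≠ c for every p ∈ Ω. Then the sublevel set N := {x ∈ M | φ(x) ≤ c} satisfies f(N) ⊆ {x ∈ M | φ(x) < c} ⊆ interior(N); in particular N is a trapping region for f. -/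
/-- Regular sublevel sets of a continuous Lyapunov function are trapping regions: if `φ` is a
continuous Lyapunov function for a bijection `f` with set of periodic points `Ω` and `c` is
not a value of `φ` on `Ω`, then `N = {φ ≤ c}` satisfies
`f(N) ⊆ {φ < c} ⊆ interior N`. -/
theorem sublevel_is_trapping {M : Type*} [TopologicalSpace M] (f : M ≃ M)
    (Ω : Set M) (hΩ : Ω = {x | ∃ n ≥ 1, (⇑f)^[n] x = x}) (φ : M → ℝ)
    (hφ : Continuous φ)
    (h₁ : ∀ x ∉ Ω, φ (f x) < φ x) (h₂ : ∀ x ∈ Ω, φ (f x) = φ x)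
    (c : ℝ) (hc : ∀ p ∈ Ω, φ p ≠ c) :
    ⇑f '' {x | φ x ≤ c} ⊆ {x | φ x < c} ∧
      {x | φ x < c} ⊆ interior {x | φ x ≤ c} := by
  refine ⟨?_, interior_maximal (Set.ofPred_subset_ofPred.2 fun _ => le_of_lt)
    (isOpen_lt hφ continuous_const)⟩
  rintro _ ⟨x, hx, rfl⟩
  by_cases hxΩ : x ∈ Ω
  · exact (h₂ x hxΩ).trans_lt (lt_of_le_of_ne hx (hc x hxΩ))
  · exact (h₁ x hxΩ).trans_le hx
end

section
/- Let M be a topological space, f : M → M a homeomorphism, and N ⊆ M a set with f(N) ⊆ interior(N). Set A := ⋂_{k≥0} f^{k}(N), B := ⋃_{k≥0} f^{-k}(N), and let K := N \ f(interior N) be the fundamental annulus of the trapping region. Then B \ A = ⋃_{n∈ℤ} f^{n}(K), i.e. the basin minus the attractor is tiled by the integer iterates of K. -/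
theorem Equiv.Perm.mem_image_zpow_iff {α : Type*} (e : Equiv.Perm α) (n : ℤ) (S : Set α) (x : α) :
    x ∈ ⇑(e ^ n) '' S ↔ (e ^ (-n)) x ∈ S := by
  rw [Equiv.image_eq_preimage_symm, zpow_neg]
  rfl

theorem Equiv.Perm.antitone_image_zpow {α : Type*} (e : Equiv.Perm α) {S : Set α}
    (h : ⇑e '' S ⊆ S) : Antitone fun n : ℤ => ⇑(e ^ n) '' S := by
  refine antitone_int_of_succ_le fun n => ?_
  rw [zpow_add_one, Equiv.Perm.coe_mul, Set.image_comp]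
  exact Set.image_mono h


/-- For a trapping region `N` of a homeomorphism `f`, with attractor `A = ⋂ k, f^[k] '' N`,
basin `B = ⋃ k, f^[k] ⁻¹' N` and fundamental annulus `K = N \ f(interior N)`, the difference
`B \ A` is tiled by the integer iterates of `K`: `B \ A = ⋃ n : ℤ, f^n '' K`. -/
theorem basin_diff_attractor_eq_iUnion_annulus {M : Type*} [TopologicalSpace M]
    (f : M ≃ₜ M) (N : Set M) (hN : ⇑f '' N ⊆ interior N) :
    (⋃ k : ℕ, (⇑f)^[k] ⁻¹' N) \ (⋂ k : ℕ, (⇑f)^[k] '' N) =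
      ⋃ n : ℤ, ⇑(f.toEquiv ^ n) '' (N \ (⇑f '' interior N)) := by
  have hsub : ⇑f.toEquiv '' N ⊆ N := hN.trans interior_subset
  have anti := Equiv.Perm.antitone_image_zpow f.toEquiv hsub
  have hiter (k : ℕ) : (⇑f)^[k] = ⇑(f.toEquiv ^ (k : ℤ)) := by
    rw [zpow_natCast]
    exact Equiv.Perm.iterate_eq_pow f.toEquiv k
  have hpre (k : ℕ) : (⇑f)^[k] ⁻¹' N = ⇑(f.toEquiv ^ (-(k : ℤ))) '' N := by
    ext x
    rw [Equiv.Perm.mem_image_zpow_iff, neg_neg, hiter, Set.mem_preimage]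
  have hann (n : ℤ) : ⇑(f.toEquiv ^ n) '' (N \ (⇑f '' interior N)) =
      (⇑(f.toEquiv ^ n) '' N) \ (⇑(f.toEquiv ^ (n + 1)) '' interior N) := by
    rw [Set.image_sdiff (f.toEquiv ^ n).injective, zpow_add_one, Equiv.Perm.coe_mul, Set.image_comp]
    rfl
  ext x
  simp only [hpre]
  simp only [hiter, hann, Set.mem_sdiff, Set.mem_iUnion, Set.mem_iInter, not_forall]
  constructor
  · rintro ⟨⟨k, hk⟩, m, hm⟩
    obtain ⟨n, hn, hmax⟩ := Int.exists_greatest_of_bdd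
      (P := fun n => x ∈ ⇑(f.toEquiv ^ n) '' N)
      ⟨m, fun z hz => le_of_not_ge fun hmz => hm (anti hmz hz)⟩ ⟨_, hk⟩
    refine ⟨n, hn, fun h => ?_⟩
    have := hmax (n + 1) (Set.image_mono interior_subset h)
    omega
  · rintro ⟨n, hn, hn'⟩
    refine ⟨⟨n.natAbs, anti (show -(n.natAbs : ℤ) ≤ n by omega) hn⟩, (n + 2).natAbs, fun h => hn' ?_⟩
    have h2 : x ∈ ⇑(f.toEquiv ^ (n + 1 + 1)) '' N :=
      anti (show n + 1 + 1 ≤ ((n + 2).natAbs : ℤ) by omega) h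
    rw [zpow_add_one, Equiv.Perm.coe_mul, Set.image_comp] at h2
    exact Set.image_mono hN h2
end

section
/- Let M be a topological space, f : M → M a bijection with set of periodic points Ω, and φ : M → ℝ a Lyapunov function for f which is continuous at a point p ∈ M. Let x ∉ Ω be a non-periodic point such that some subsequence (f^{-n_j}(x))_{j} with n_j → ∞ converges to p. Then φ(x) < φ(p). (This is the inequality φ(x) < φ(p) for points x ≠ p of the unstable manifold of a periodic point p.) -/
/-- If `φ` is a Lyapunov function for a bijection `f` (with set of periodic points `Ω`),
continuous at `p`, and `x` is a non-periodic point such that some subsequence of its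
backward orbit `f⁻¹^[n j] x` with `n j → ∞` converges to `p`, then `φ x < φ p`.
(Inequality for points of the unstable manifold of `p`.) -/
theorem lyapunov_lt_on_unstable {M : Type*} [TopologicalSpace M] (f : M ≃ M)
    (Ω : Set M) (hΩ : Ω = {x | ∃ n ≥ 1, (⇑f)^[n] x = x}) (φ : M → ℝ)
    (h₁ : ∀ x ∉ Ω, φ (f x) < φ x) (h₂ : ∀ x ∈ Ω, φ (f x) = φ x)
    (p : M) (hp : ContinuousAt φ p) (x : M) (hx : x ∉ Ω)
    (n : ℕ → ℕ) (hn : Filter.Tendsto n Filter.atTop Filter.atTop)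
    (hconv : Filter.Tendsto (fun j => (⇑f.symm)^[n j] x) Filter.atTop (nhds p)) :
    φ x < φ p := by
  have hle : ∀ y, φ y ≤ φ (f.symm y) := fun y => by
    by_cases hy : f.symm y ∈ Ω
    · simpa using (h₂ _ hy).le
    · simpa using (h₁ _ hy).le
  have hx' : f.symm x ∉ Ω := by
    subst hΩ
    rintro ⟨k, hk, hkx⟩
    refine hx ⟨k, hk, ?_⟩
    have h := congrArg f hkx
    rwa [← Function.iterate_succ_apply' f, Function.iterate_succ_apply,
      f.apply_symm_apply] at h
  have hlt : φ x < φ (f.symm x) := by simpa using h₁ _ hx'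
  have hmono : Monotone fun k => φ ((⇑f.symm)^[k] x) :=
    monotone_nat_of_le_succ fun k => by
      rw [Function.iterate_succ_apply']
      exact hle _
  refine hlt.trans_le (ge_of_tendsto (hp.tendsto.comp hconv) ?_)
  filter_upwards [hn.eventually_ge_atTop 1] with j hj
  exact hmono hj
end

section
/- Let M be a topological space, f : M → M a bijection with set of periodic points Ω, and φ : M → ℝ a Lyapunov function for f which is continuous at a point p ∈ M. Let x ∉ Ω be a non-periodic point such that some subsequence (f^{n_j}(x))_{j} with n_j → ∞ converges to p. Then φ(x) > φ(p). (This is the inequality φ(x) > φ(p) for points x ≠ p of the stable manifold of a periodic point p.) -/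
/-- If `φ` is a Lyapunov function for a bijection `f` (with set of periodic points `Ω`),
continuous at `p`, and `x` is a non-periodic point such that some subsequence of its
forward orbit `f^[n j] x` with `n j → ∞` converges to `p`, then `φ x > φ p`.
(Inequality for points of the stable manifold of `p`.) -/
theorem lyapunov_gt_on_stable {M : Type*} [TopologicalSpace M] (f : M ≃ M)
    (Ω : Set M) (hΩ : Ω = {x | ∃ n ≥ 1, (⇑f)^[n] x = x}) (φ : M → ℝ)
    (h₁ : ∀ x ∉ Ω, φ (f x) < φ x) (h₂ : ∀ x ∈ Ω, φ (f x) = φ x)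
    (p : M) (hp : ContinuousAt φ p) (x : M) (hx : x ∉ Ω)
    (n : ℕ → ℕ) (hn : Filter.Tendsto n Filter.atTop Filter.atTop)
    (hconv : Filter.Tendsto (fun j => (⇑f)^[n j] x) Filter.atTop (nhds p)) :
    φ x > φ p := by
  have hle : ∀ y, φ (f y) ≤ φ y := fun y => by
    by_cases hy : y ∈ Ω
    · exact (h₂ y hy).le
    · exact (h₁ y hy).le
  have hanti : Antitone fun k => φ ((⇑f)^[k] x) := antitone_nat_of_succ_le fun k => by
    rw [Function.iterate_succ_apply']
    exact hle _
  have hlim : Filter.Tendsto (fun j => φ ((⇑f)^[n j] x)) Filter.atTop (nhds (φ p)) :=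
    hp.tendsto.comp hconv
  have hp_le : φ p ≤ φ (f x) := by
    refine le_of_tendsto hlim ?_
    filter_upwards [hn.eventually_ge_atTop 1] with j hj
    exact hanti hj
  exact hp_le.trans_lt (h₁ x hx)
end
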